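/- arXiv:1609.01677 — 2 statements merged into one kernel-verified Lean document; each statement's English description precedes it below -/
import Mathlib

section
/- Let k, Δ be positive integers and let G be a finite simple graph with f(G) < k whose maximum degree is at most Δ. Then G contains at most (Δ²+1)·k vertices of degree at least k-1. -/
open Finset
open scoped Classical

/-- The number of distinct vertex degrees in the subgraph of `G` induced by `s`. -/
noncomputable def distinctDegrees {V : Type*} (G : SimpleGraph V) (s : Finset V) : ℕ :=
  (s.image fun x => (s.filter fun y => G.Adj x y).card).card

/-- `f(G)`: the largest number of distinct degrees in an induced subgraph of `G`. -/
noncomputable def fNumber {V : Type*} [Fintype V] (G : SimpleGraph V) : ℕ :=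
  sSup {m : ℕ | ∃ s : Finset V, distinctDegrees G s = m}

/-- `hom(G)`: the size of the largest clique or independent set of `G`. -/
noncomputable def homNumber {V : Type*} (G : SimpleGraph V) : ℕ :=
  sSup {n : ℕ | ∃ s : Finset V, (G.IsClique ↑s ∨ Gᶜ.IsClique ↑s) ∧ s.card = n}

/-- The neighbourhood-distance `δ(x,y) = |(Γ(x)\{y}) △ (Γ(y)\{x})|`. -/
noncomputable def nbhdDist {V : Type*} [Fintype V] (G : SimpleGraph V) (x y : V) : ℕ :=
  (symmDiff ((G.neighborFinset x).erase y) ((G.neighborFinset y).erase x)).card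

theorem distinctDegrees_le_fNumber {V : Type*} [Fintype V] (G : SimpleGraph V) (s : Finset V) :
    distinctDegrees G s ≤ fNumber G := by
  refine le_csSup ⟨Fintype.card V, ?_⟩ ⟨s, rfl⟩
  rintro m ⟨t, rfl⟩
  exact card_image_le.trans (card_le_univ t)

/-- Greedy selection of pairwise unrelated elements when every element is related to at most `D`
elements, itself included. -/
theorem exists_subset_card_eq_pairwise_not {V : Type*} [Fintype V] (R : V → V → Prop)
    (hrefl : ∀ v, R v v) (hsymm : ∀ v w, R v w → R w v) (D : ℕ)
    (hD : ∀ v, (univ.filter (R v)).card ≤ D) (n : ℕ) (S : Finset V) (hS : D * n < S.card) :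
    ∃ T ⊆ S, T.card = n ∧ (T : Set V).Pairwise fun v w => ¬ R v w := by
  induction n generalizing S with
  | zero => exact ⟨∅, by simp⟩
  | succ n ih =>
    obtain ⟨v, hv⟩ : S.Nonempty := card_pos.mp (by omega)
    have hcard : D * n < (S \ univ.filter (R v)).card := by
      have h₁ := le_card_sdiff (univ.filter (R v)) S
      have h₂ := hD v
      rw [mul_add, mul_one] at hS
      omega
    obtain ⟨T, hTS, hT, hpair⟩ := ih _ hcard
    have hvT : ∀ w ∈ T, ¬ R v w := fun w hw => by
      simpa using (mem_sdiff.mp (hTS hw)).2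
    refine ⟨insert v T, ?_, ?_, ?_⟩
    · exact insert_subset hv (hTS.trans sdiff_subset)
    · rw [card_insert_of_notMem fun h => hvT v h (hrefl v), hT]
    · rw [coe_insert]
      refine hpair.insert fun w hw _ => ⟨hvT w hw, fun h => hvT w hw (hsymm _ _ h)⟩

/-- A ball of radius two has at most `Δ ^ 2 + 1` vertices. -/
theorem card_filter_eq_or_adj_or_common_le {V : Type*} [Fintype V] (G : SimpleGraph V) (Δ : ℕ)
    (hdeg : ∀ v : V, G.degree v ≤ Δ) (v : V) :
    (univ.filter fun w => v = w ∨ G.Adj v w ∨ ∃ u, G.Adj v u ∧ G.Adj u w).card ≤ Δ ^ 2 + 1 := by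
  have hsub : (univ.filter fun w => v = w ∨ G.Adj v w ∨ ∃ u, G.Adj v u ∧ G.Adj u w) ⊆
      insert v ((G.neighborFinset v).biUnion fun u => insert u ((G.neighborFinset u).erase v)) := by
    intro w hw
    simp only [mem_filter, mem_univ, true_and] at hw
    simp only [mem_insert, mem_biUnion, mem_erase, SimpleGraph.mem_neighborFinset]
    by_cases hvw : w = v
    · exact Or.inl hvw
    · rcases hw with h | h | ⟨u, hu, huw⟩
      · exact absurd h.symm hvw
      · exact Or.inr ⟨w, h, Or.inl rfl⟩
      · exact Or.inr ⟨u, hu, Or.inr ⟨hvw, huw⟩⟩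
  have hstar : ∀ u ∈ G.neighborFinset v,
      (insert u ((G.neighborFinset u).erase v)).card ≤ Δ := fun u hu => by
    have hvu : v ∈ G.neighborFinset u := by
      rw [SimpleGraph.mem_neighborFinset] at hu ⊢
      exact hu.symm
    have h₁ := card_insert_le u ((G.neighborFinset u).erase v)
    have h₂ := card_erase_add_one hvu
    have h₃ := hdeg u
    rw [← G.card_neighborFinset_eq_degree] at h₃
    omega
  calc _ ≤ _ := card_le_card hsub
    _ ≤ _ := card_insert_le _ _
    _ ≤ (G.neighborFinset v).card * Δ + 1 := by
      gcongr
      exact card_biUnion_le_card_mul _ _ _ hstar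
    _ ≤ Δ * Δ + 1 := by
      gcongr
      exact hdeg v
    _ = Δ ^ 2 + 1 := by ring

/-- Vertices of degree at least `k - 1` at pairwise distance at least three, if there are `k` of
them, yield an induced subgraph with `k` distinct degrees. -/
theorem card_le_fNumber_of_pairwise {V : Type*} [Fintype V] (G : SimpleGraph V) (T : Finset V)
    (hT : ∀ v ∈ T, T.card - 1 ≤ G.degree v)
    (hpair : (T : Set V).Pairwise fun v w =>
      ¬ (v = w ∨ G.Adj v w ∨ ∃ u, G.Adj v u ∧ G.Adj u w)) :
    T.card ≤ fNumber G := by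
  have hex : ∀ v : T, ∃ A ⊆ G.neighborFinset v, A.card = (T.equivFin v : ℕ) := fun v => by
    refine exists_subset_card_eq ?_
    have h₁ := hT v v.2
    have h₂ := (T.equivFin v).2
    rw [← G.card_neighborFinset_eq_degree] at h₁
    omega
  choose A hA hcard using hex
  have hadj : ∀ (v : T) {w : V}, w ∈ A v → G.Adj v w := fun v w hw =>
    (G.mem_neighborFinset _ _).mp (hA v hw)
  set s := T ∪ univ.biUnion A
  have hfilter : ∀ v : T, (s.filter fun y => G.Adj v y) = A v := fun v => by
    ext y
    simp only [s, mem_filter, mem_union, mem_biUnion, mem_univ, true_and]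
    constructor
    · rintro ⟨hy | ⟨w, hw⟩, hvy⟩
      · exact absurd (Or.inr (Or.inl hvy)) (hpair v.2 hy hvy.ne)
      · by_cases hvw : v = w
        · exact hvw ▸ hw
        · exact absurd (Or.inr (Or.inr ⟨y, hvy, (hadj w hw).symm⟩))
            (hpair v.2 w.2 (Subtype.coe_ne_coe.mpr hvw))
    · exact fun hy => ⟨Or.inr ⟨v, hy⟩, hadj v hy⟩
  refine le_trans ?_ (distinctDegrees_le_fNumber G s)
  have hsub : range T.card ⊆ s.image fun x => (s.filter fun y => G.Adj x y).card := by
    intro i hi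
    let v := T.equivFin.symm ⟨i, mem_range.mp hi⟩
    refine mem_image.mpr ⟨v, mem_union_left _ v.2, ?_⟩
    rw [hfilter, hcard, Equiv.apply_symm_apply]
  simpa [distinctDegrees] using card_le_card hsub

/-- If `f(G) < k` and `G` has maximum degree at most `Δ`, then `G` has at most `(Δ²+1)·k`
vertices of degree at least `k-1`. -/
theorem stmt_3 {V : Type*} [Fintype V] (k Δ : ℕ) (hk : 0 < k) (hΔ : 0 < Δ)
    (G : SimpleGraph V) (hf : fNumber G < k) (hdeg : ∀ v : V, G.degree v ≤ Δ) :
    (Finset.univ.filter fun v : V => k - 1 ≤ G.degree v).card ≤ (Δ ^ 2 + 1) * k := by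
  by_contra! hlt
  obtain ⟨T, hTS, rfl, hpair⟩ := exists_subset_card_eq_pairwise_not
    (fun v w => v = w ∨ G.Adj v w ∨ ∃ u, G.Adj v u ∧ G.Adj u w) (fun _ => Or.inl rfl)
    (by
      rintro v w (h | h | ⟨u, hu, hw⟩)
      · exact Or.inl h.symm
      · exact Or.inr (Or.inl h.symm)
      · exact Or.inr (Or.inr ⟨u, hw.symm, hu.symm⟩))
    (Δ ^ 2 + 1) (fun v => by convert card_filter_eq_or_adj_or_common_le G Δ hdeg v) k _ hlt
  exact hf.not_ge (card_le_fNumber_of_pairwise G T (fun v hv => (mem_filter.mp (hTS hv)).2) hpair)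
end

section
/- Let G be a finite simple graph and let x be any vertex of G. Then Σ_{y ∈ V(G), y ≠ x} 1/(δ(x,y)+1) ≤ 2·hom(G). -/
open Finset
open scoped Classical

/-- **Caro–Wei bound**, relative to a vertex set `s`. -/
theorem exists_indep_subset_caroWei {V : Type*} (H : SimpleGraph V) (s : Finset V) :
    ∃ t ⊆ s, Hᶜ.IsClique (t : Set V) ∧
      ∑ v ∈ s, (1 : ℝ) / (((s.filter (H.Adj v)).card : ℝ) + 1) ≤ (t.card : ℝ) := by
  induction s using Finset.strongInduction with
  | H s ih =>
    rcases s.eq_empty_or_nonempty with rfl | hs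
    · exact ⟨∅, by simp⟩
    obtain ⟨v, hv, hmin⟩ := s.exists_min_image (fun v => (s.filter (H.Adj v)).card) hs
    have hvr : v ∉ s.filter (fun w => w ≠ v ∧ ¬ H.Adj v w) := by simp
    obtain ⟨t, hts, ht, hsum⟩ :=
      ih (s.filter fun w => w ≠ v ∧ ¬ H.Adj v w)
        ((Finset.filter_subset _ _).ssubset_of_ne fun h => hvr (h.symm ▸ hv))
    refine ⟨insert v t, ?_, ?_, ?_⟩
    · exact Finset.insert_subset hv (hts.trans (Finset.filter_subset _ _))
    · rw [Finset.coe_insert]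
      refine ht.insert fun w hw hne => ?_
      have := Finset.mem_filter.1 (hts hw)
      exact (SimpleGraph.compl_adj ..).2 ⟨hne, this.2.2⟩
    · rw [Finset.card_insert_of_notMem fun h => hvr (hts h),
        ← Finset.sum_filter_add_sum_filter_not s (fun w => w ≠ v ∧ ¬ H.Adj v w)]
      push_cast
      refine add_le_add (le_trans (Finset.sum_le_sum fun w _ => ?_) hsum) ?_
      · gcongr
        exact Finset.filter_subset _ _
      · have hclosed : s.filter (fun w => ¬ (w ≠ v ∧ ¬ H.Adj v w)) =
            insert v (s.filter (H.Adj v)) := by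
          ext w
          simp only [Finset.mem_filter, Finset.mem_insert]
          by_cases hw : w = v
          · simp [hw, hv]
          · simp [hw]
        rw [hclosed]
        refine (Finset.sum_le_card_nsmul _ _
          ((1 : ℝ) / (((s.filter (H.Adj v)).card : ℝ) + 1)) fun w hw => ?_).trans ?_
        · have hws : w ∈ s := by
            rcases Finset.mem_insert.1 hw with rfl | hw
            · exact hv
            · exact (Finset.mem_filter.1 hw).1
          have hvw : ((s.filter (H.Adj v)).card : ℝ) ≤ (s.filter (H.Adj w)).card := by
            exact_mod_cast hmin w hws
          exact one_div_le_one_div_of_le (by positivity) (by linarith)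
        · rw [Finset.card_insert_of_notMem (by simp), nsmul_eq_mul]
          push_cast
          exact (mul_one_div_cancel (by positivity)).le

theorem card_le_homNumber {V : Type*} [Fintype V] (G : SimpleGraph V) (s : Finset V)
    (hs : G.IsClique (s : Set V) ∨ Gᶜ.IsClique (s : Set V)) : s.card ≤ homNumber G := by
  refine le_csSup ⟨Fintype.card V, ?_⟩ ⟨s, hs, rfl⟩
  rintro _ ⟨t, -, rfl⟩
  exact Finset.card_le_univ t

theorem sum_one_div_nbhdDist_le {V : Type*} [Fintype V] (G H : SimpleGraph V) (x : V)
    (s : Finset V) (hH : H = G ∨ H = Gᶜ)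
    (hs : ∀ y ∈ s, (s.filter (H.Adj y)).card ≤ nbhdDist G x y) :
    ∑ y ∈ s, (1 : ℝ) / ((nbhdDist G x y : ℝ) + 1) ≤ (homNumber G : ℝ) := by
  obtain ⟨t, -, ht, hsum⟩ := exists_indep_subset_caroWei H s
  have hle : t.card ≤ homNumber G := by
    refine card_le_homNumber G t ?_
    rcases hH with rfl | rfl
    · exact .inr ht
    · exact .inl (by rwa [compl_compl] at ht)
  refine le_trans (Finset.sum_le_sum fun y hy => ?_) (hsum.trans (by exact_mod_cast hle))
  gcongr
  exact hs y hy

/-- For any vertex `x` of `G`, `Σ_{y ≠ x} 1/(δ(x,y)+1) ≤ 2·hom(G)`. -/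
theorem stmt_8 {V : Type*} [Fintype V] (G : SimpleGraph V) (x : V) :
    ∑ y ∈ Finset.univ.erase x, (1 : ℝ) / ((nbhdDist G x y : ℝ) + 1) ≤
      2 * (homNumber G : ℝ) := by
  rw [← Finset.sum_filter_add_sum_filter_not _ (G.Adj x), two_mul]
  refine add_le_add (sum_one_div_nbhdDist_le G Gᶜ x _ (.inr rfl) fun y hy => ?_)
    (sum_one_div_nbhdDist_le G G x _ (.inl rfl) fun y hy => ?_)
  all_goals
    refine Finset.card_le_card fun z hz => ?_
    simp only [Finset.mem_filter, Finset.mem_erase, Finset.mem_univ, and_true,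
      SimpleGraph.compl_adj, Finset.mem_symmDiff, SimpleGraph.mem_neighborFinset] at hy hz ⊢
    grind [G.ne_of_adj]
end
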